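/- For an object X = (g1: G1 → G0) of Mon(ω,𝒢), the following are equivalent: (i) X is a projective object, i.e. every short exact sequence in Mon(ω,𝒢) whose third term is X splits; (ii) X is an injective object, i.e. every short exact sequence in Mon(ω,𝒢) whose first term is X splits; (iii) X is a direct summand of an object of the form (id: P → P) ⊕ (ω: Q → Q) for some finitely generated projective S-modules P, Q. In particular, Mon(ω,𝒢) is a Frobenius category. -/

import Mathlib

open CategoryTheory LinearMap Function

/-- A module `M` over a commutative ring `A` is *Gorenstein projective* if the biduality
map `M → Hom_A(Hom_A(M,A),A)` is an isomorphism and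
`Ext^i_A(M,A) = 0 = Ext^i_A(Hom_A(M,A),A)` for all `i ≥ 1`. -/
noncomputable def IsGP (A : Type) [CommRing A] (M : Type) [AddCommGroup M] [Module A M] : Prop :=
  Function.Bijective (Module.Dual.eval A M) ∧
  (∀ i : ℕ, 0 < i →
    Subsingleton (((Ext A (ModuleCat A) i).obj
      (Opposite.op (ModuleCat.of A M))).obj (ModuleCat.of A A))) ∧
  (∀ i : ℕ, 0 < i →
    Subsingleton (((Ext A (ModuleCat A) i).obj
      (Opposite.op (ModuleCat.of A (Module.Dual A M)))).obj (ModuleCat.of A A)))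

/-- `f : G1 → G0` is an object of the monomorphism category `Mon(ω, 𝒢)`:
`G1`, `G0` are finitely generated Gorenstein projective `S`-modules, `f` is injective,
and `ω · Coker f = 0` (i.e. `ω • y ∈ range f` for all `y`). -/
def MonObj (S : Type) [CommRing S] (ω : S) {G1 G0 : Type}
    [AddCommGroup G1] [Module S G1] [AddCommGroup G0] [Module S G0]
    (f : G1 →ₗ[S] G0) : Prop :=
  Module.Finite S G1 ∧ Module.Finite S G0 ∧ IsGP S G1 ∧ IsGP S G0 ∧
  Function.Injective f ∧ ∀ y : G0, ω • y ∈ LinearMap.range f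

/-- An object `(g1 : G1 → G0)` of `Mon(ω, 𝒢)` is projective: every conflation of
`Mon(ω, 𝒢)` whose third term is `(g1 : G1 → G0)` splits (admits a section). -/
noncomputable def IsProjObjMon (S : Type) [CommRing S] (ω : S) {G1 G0 : Type}
    [AddCommGroup G1] [Module S G1] [AddCommGroup G0] [Module S G0]
    (g1 : G1 →ₗ[S] G0) : Prop :=
  ∀ (A1 A0 B1 B0 : ModuleCat S) (a : A1 →ₗ[S] A0) (b : B1 →ₗ[S] B0)
      (α1 : A1 →ₗ[S] B1) (α0 : A0 →ₗ[S] B0)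
      (β1 : B1 →ₗ[S] G1) (β0 : B0 →ₗ[S] G0),
    MonObj S ω a → MonObj S ω b →
    b ∘ₗ α1 = α0 ∘ₗ a → g1 ∘ₗ β1 = β0 ∘ₗ b →
    Function.Injective α1 → Function.Injective α0 →
    Function.Exact α1 β1 → Function.Exact α0 β0 →
    Function.Surjective β1 → Function.Surjective β0 →
    ∃ (ψ1 : G1 →ₗ[S] B1) (ψ0 : G0 →ₗ[S] B0),
      b ∘ₗ ψ1 = ψ0 ∘ₗ g1 ∧ β1 ∘ₗ ψ1 = LinearMap.id ∧ β0 ∘ₗ ψ0 = LinearMap.id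

/-- An object `(g1 : G1 → G0)` of `Mon(ω, 𝒢)` is injective: every conflation of
`Mon(ω, 𝒢)` whose first term is `(g1 : G1 → G0)` splits (admits a retraction). -/
noncomputable def IsInjObjMon (S : Type) [CommRing S] (ω : S) {G1 G0 : Type}
    [AddCommGroup G1] [Module S G1] [AddCommGroup G0] [Module S G0]
    (g1 : G1 →ₗ[S] G0) : Prop :=
  ∀ (B1 B0 C1 C0 : ModuleCat S) (b : B1 →ₗ[S] B0) (c : C1 →ₗ[S] C0)
      (α1 : G1 →ₗ[S] B1) (α0 : G0 →ₗ[S] B0)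
      (β1 : B1 →ₗ[S] C1) (β0 : B0 →ₗ[S] C0),
    MonObj S ω b → MonObj S ω c →
    b ∘ₗ α1 = α0 ∘ₗ g1 → c ∘ₗ β1 = β0 ∘ₗ b →
    Function.Injective α1 → Function.Injective α0 →
    Function.Exact α1 β1 → Function.Exact α0 β0 →
    Function.Surjective β1 → Function.Surjective β0 →
    ∃ (ψ1 : B1 →ₗ[S] G1) (ψ0 : B0 →ₗ[S] G0),
      g1 ∘ₗ ψ1 = ψ0 ∘ₗ b ∧ ψ1 ∘ₗ α1 = LinearMap.id ∧ ψ0 ∘ₗ α0 = LinearMap.id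

/-- An object `(g1 : G1 → G0)` of `Mon(ω, 𝒢)` is a direct summand (in `Mon(ω, 𝒢)`) of an
object of the form `(id : P → P) ⊕ (ω : Q → Q)` with `P, Q` finitely generated
projective `S`-modules. -/
noncomputable def IsSummandOfStdObj (S : Type) [CommRing S] (ω : S) {G1 G0 : Type}
    [AddCommGroup G1] [Module S G1] [AddCommGroup G0] [Module S G0]
    (g1 : G1 →ₗ[S] G0) : Prop :=
  ∃ (P Q : ModuleCat.{0} S),
    Module.Finite S P ∧ Module.Projective S P ∧
    Module.Finite S Q ∧ Module.Projective S Q ∧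
    ∃ (s1 : G1 →ₗ[S] P × Q) (s0 : G0 →ₗ[S] P × Q)
      (r1 : P × Q →ₗ[S] G1) (r0 : P × Q →ₗ[S] G0),
      ((LinearMap.id : P →ₗ[S] P).prodMap (ω • (LinearMap.id : Q →ₗ[S] Q))) ∘ₗ s1 =
          s0 ∘ₗ g1 ∧
      g1 ∘ₗ r1 =
          r0 ∘ₗ ((LinearMap.id : P →ₗ[S] P).prodMap (ω • (LinearMap.id : Q →ₗ[S] Q))) ∧
      r1 ∘ₗ s1 = LinearMap.id ∧ r0 ∘ₗ s0 = LinearMap.id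

lemma ext_iff' {S : Type} [CommRing S] {M N : ModuleCat.{0} S} (P : ProjectiveResolution M) (n : ℕ) :
    Subsingleton (((Ext S (ModuleCat S) (n+1)).obj (Opposite.op M)).obj N) ↔
    ∀ φ : P.complex.X (n+1) ⟶ N, P.complex.d (n+2) (n+1) ≫ φ = 0 →
      ∃ ψ : P.complex.X n ⟶ N, P.complex.d (n+1) n ≫ ψ = φ := by
  rw [← ModuleCat.isZero_iff_subsingleton, (P.isoExt (n+1) N).isZero_iff,
   ← HomologicalComplex.exactAt_iff_isZero_homology,
   HomologicalComplex.exactAt_iff' _ n (n+1) (n+2) (by simp) (by simp),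
   ShortComplex.moduleCat_exact_iff]
  rfl

/-- The augmentation map of a projective resolution. -/
noncomputable def pz {S : Type} [CommRing S] {M : ModuleCat.{0} S} (P : ProjectiveResolution M) :
    P.complex.X 0 ⟶ M := P.π.f 0

lemma pz_d {S : Type} [CommRing S] {M : ModuleCat.{0} S} (P : ProjectiveResolution M) :
    P.complex.d 1 0 ≫ pz P = 0 := P.complex_d_comp_π_f_zero

instance pz_epi {S : Type} [CommRing S] {M : ModuleCat.{0} S} (P : ProjectiveResolution M) :
    Epi (pz P) := (inferInstance : Epi (P.π.f 0))

lemma pz_exact {S : Type} [CommRing S] {M : ModuleCat.{0} S} (P : ProjectiveResolution M) :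
    (ShortComplex.mk (P.complex.d 1 0) (pz P) (pz_d P)).Exact := P.exact₀

lemma pz_desc {S : Type} [CommRing S] {M N : ModuleCat.{0} S} (P : ProjectiveResolution M)
    (φ : P.complex.X 0 ⟶ N) (h : P.complex.d 1 0 ≫ φ = 0) : ∃ ψ : M ⟶ N, pz P ≫ ψ = φ := by
  obtain ⟨φ', hφ'⟩ := Limits.CokernelCofork.IsColimit.desc' P.isColimitCokernelCofork φ h
  exact ⟨φ', hφ'⟩

/-- Splicing. -/
noncomputable def spliceComplex {S : Type} [CommRing S] (T : ShortComplex (ModuleCat.{0} S))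
    (P : ProjectiveResolution T.X₁) : ChainComplex (ModuleCat.{0} S) ℕ :=
  ChainComplex.augment P.complex (X := T.X₂) (pz P ≫ T.f) (by
    rw [← Category.assoc, pz_d, Limits.zero_comp])

lemma exact_aug {S : Type} [CommRing S] (T : ShortComplex (ModuleCat.{0} S))
    (hT : T.ShortExact) (P : ProjectiveResolution T.X₁) :
    (ShortComplex.mk (pz P ≫ T.f) T.g (by rw [Category.assoc, T.zero, Limits.comp_zero])).Exact := by
  have := hT.exact
  let α : ShortComplex.mk (pz P ≫ T.f) T.g (by rw [Category.assoc, T.zero, Limits.comp_zero]) ⟶ T :=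
    { τ₁ := pz P
      τ₂ := 𝟙 _
      τ₃ := 𝟙 _ 
      comm₁₂ := (Category.comp_id _).symm
      comm₂₃ := by rw [Category.comp_id]; exact Category.id_comp _ }
  have e1 : Epi α.τ₁ := (inferInstance : Epi (pz P))
  have e2 : IsIso α.τ₂ := (inferInstance : IsIso (𝟙 T.X₂))
  have e3 : Mono α.τ₃ := (inferInstance : Mono (𝟙 T.X₃))
  rwa [ShortComplex.exact_iff_of_epi_of_isIso_of_mono α]

lemma exact_aug1 {S : Type} [CommRing S] (T : ShortComplex (ModuleCat.{0} S))
    (hT : T.ShortExact) (P : ProjectiveResolution T.X₁) :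
    (ShortComplex.mk (P.complex.d 1 0) (pz P ≫ T.f) (by
    rw [← Category.assoc, pz_d, Limits.zero_comp])).Exact := by
  have := pz_exact P
  have := hT.mono_f
  let α : ShortComplex.mk (P.complex.d 1 0) (pz P) (pz_d P) ⟶ ShortComplex.mk (P.complex.d 1 0) (pz P ≫ T.f) (by
    rw [← Category.assoc, pz_d, Limits.zero_comp]) :=
    { τ₁ := 𝟙 _
      τ₂ := 𝟙 _
      τ₃ := T.f
      comm₁₂ := by rw [Category.comp_id]; exact Category.id_comp _
      comm₂₃ := Category.id_comp _ }
  have e1 : Epi α.τ₁ := (inferInstance : Epi (𝟙 (P.complex.X 1)))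
  have e2 : IsIso α.τ₂ := (inferInstance : IsIso (𝟙 (P.complex.X 0)))
  have e3 : Mono α.τ₃ := hT.mono_f
  rwa [← ShortComplex.exact_iff_of_epi_of_isIso_of_mono α]

noncomputable def splice {S : Type} [CommRing S] (T : ShortComplex (ModuleCat.{0} S))
    (hT : T.ShortExact) (hP : Projective T.X₂)
    (P : ProjectiveResolution T.X₁) : ProjectiveResolution T.X₃ where
  complex := spliceComplex T P
  projective n := by
    cases n with
    | zero => exact hP
    | succ n => exact P.projective n
  π := (ChainComplex.toSingle₀Equiv (spliceComplex T P) _).symm ⟨T.g, by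
    change (pz P ≫ T.f) ≫ T.g = 0
    rw [Category.assoc, T.zero, Limits.comp_zero]⟩
  quasiIso := ⟨fun n => by
    have := hT.epi_g
    cases n
    · rw [ChainComplex.quasiIsoAt₀_iff, ShortComplex.quasiIso_iff_of_zeros']
      · refine (ShortComplex.exact_and_epi_g_iff_of_iso ?_).2
          ⟨exact_aug T hT P, hT.epi_g⟩
        exact ShortComplex.isoMk (Iso.refl _) (Iso.refl _) (Iso.refl _)
          ((Category.id_comp _).trans (Category.comp_id _).symm) (by
            exact ((Category.id_comp _).trans
              (ChainComplex.toSingle₀Equiv_symm_apply_f_zero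
                (C := spliceComplex T P) T.g _).symm).trans (Category.comp_id _).symm)
      all_goals rfl
    · rename_i n
      rw [quasiIsoAt_iff_exactAt']
      · rw [HomologicalComplex.exactAt_iff' _ (n + 1 + 1) (n + 1) n (by simp) (by simp)]
        cases n with
        | zero => exact exact_aug1 T hT P
        | succ n => exact P.exact_succ n
      · apply ChainComplex.exactAt_succ_single_obj⟩

lemma ext_succ {S : Type} [CommRing S] (T : ShortComplex (ModuleCat.{0} S))
    (hT : T.ShortExact) (hP : Projective T.X₂) (N : ModuleCat.{0} S) (n : ℕ) :
    Subsingleton (((Ext S (ModuleCat S) (n+2)).obj (Opposite.op T.X₃)).obj N) ↔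
    Subsingleton (((Ext S (ModuleCat S) (n+1)).obj (Opposite.op T.X₁)).obj N) := by
  rw [ext_iff' (ProjectiveResolution.of T.X₁), 
    ext_iff' (splice T hT hP (ProjectiveResolution.of T.X₁))]
  rfl

lemma ext_one {S : Type} [CommRing S] (T : ShortComplex (ModuleCat.{0} S))
    (hT : T.ShortExact) (hP : Projective T.X₂) (N : ModuleCat.{0} S) :
    Subsingleton (((Ext S (ModuleCat S) 1).obj (Opposite.op T.X₃)).obj N) ↔
    ∀ φ : T.X₁ ⟶ N, ∃ ψ : T.X₂ ⟶ N, T.f ≫ ψ = φ := by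
  let P := ProjectiveResolution.of T.X₁
  rw [ext_iff' (splice T hT hP P) 0]
  have e : Epi (pz P) := inferInstance
  constructor
  · intro h φ
    obtain ⟨ψ, hψ⟩ := h (pz P ≫ φ) (by
      change P.complex.d 1 0 ≫ (pz P ≫ φ) = 0
      rw [← Category.assoc, pz_d, Limits.zero_comp])
    refine ⟨ψ, (cancel_epi (pz P)).1 ?_⟩
    exact (Category.assoc _ _ _).symm.trans hψ
  · intro h φ hφ
    obtain ⟨φ', hφ'⟩ := pz_desc P φ hφ
    obtain ⟨ψ, hψ⟩ := h φ'
    refine ⟨ψ, ?_⟩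
    change (pz P ≫ T.f) ≫ ψ = φ
    rw [Category.assoc, hψ]
    exact hφ'

/-- `Ext^i(M,S) = 0` for all `i ≥ 1`. -/
def EV (S : Type) [CommRing S] (M : Type) [AddCommGroup M] [Module S M] : Prop :=
  ∀ i : ℕ, 0 < i →
    Subsingleton (((Ext S (ModuleCat S) i).obj
      (Opposite.op (ModuleCat.of S M))).obj (ModuleCat.of S S))

section
variable {S : Type} [CommRing S]
  {A B C : Type} [AddCommGroup A] [Module S A] [AddCommGroup B] [Module S B]
  [AddCommGroup C] [Module S C]

lemma shortExact_of (j : A →ₗ[S] B) (p : B →ₗ[S] C)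
    (hj : Injective j) (hp : Surjective p) (hjp : Exact j p) :
    (ShortComplex.mk (ModuleCat.ofHom j) (ModuleCat.ofHom p) (by
      ext x; exact hjp.apply_apply_eq_zero x)).ShortExact where
  exact := by
    rw [ShortComplex.ShortExact.moduleCat_exact_iff_function_exact]
    exact hjp
  mono_f := (ModuleCat.mono_iff_injective _).2 hj
  epi_g := (ModuleCat.epi_iff_surjective _).2 hp

lemma EV_iff [Module.Projective S B] (j : A →ₗ[S] B) (p : B →ₗ[S] C)
    (hj : Injective j) (hp : Surjective p) (hjp : Exact j p) :
    EV S C ↔ EV S A ∧ ∀ φ : A →ₗ[S] S, ∃ ψ : B →ₗ[S] S, ψ ∘ₗ j = φ := by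
  have hT := shortExact_of j p hj hp hjp
  have hB : Projective (ModuleCat.of S B) :=
    (IsProjective.iff_projective (R := S) B).1 inferInstance
  have h1 := ext_one _ hT hB (ModuleCat.of S S)
  have h2 := ext_succ _ hT hB (ModuleCat.of S S)
  have h3 : (∀ φ : ModuleCat.of S A ⟶ ModuleCat.of S S, ∃ ψ : ModuleCat.of S B ⟶ ModuleCat.of S S,
      ModuleCat.ofHom j ≫ ψ = φ) ↔ ∀ φ : A →ₗ[S] S, ∃ ψ : B →ₗ[S] S, ψ ∘ₗ j = φ := by
    constructor
    · intro h φ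
      obtain ⟨ψ, hψ⟩ := h (ModuleCat.ofHom φ)
      exact ⟨ψ.hom, congrArg ModuleCat.Hom.hom hψ⟩
    · intro h φ
      obtain ⟨ψ, hψ⟩ := h φ.hom
      exact ⟨ModuleCat.ofHom ψ, ModuleCat.hom_ext hψ⟩
  constructor
  · intro h
    refine ⟨fun i hi => ?_, h3.1 (h1.1 (h 1 one_pos))⟩
    obtain ⟨n, rfl⟩ : ∃ n, i = n + 1 := ⟨i - 1, by omega⟩
    exact (h2 n).1 (h (n+2) (by omega))
  · rintro ⟨h, h'⟩ i hi
    match i, hi with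
    | 1, _ => exact h1.2 (h3.2 h')
    | n + 2, _ => exact (h2 n).2 (h (n+1) (by omega))

lemma EV_projective [Module.Projective S B] : EV S B := by
  intro i hi
  obtain ⟨n, rfl⟩ : ∃ n, i = n + 1 := ⟨i - 1, by omega⟩
  have hB : Projective (ModuleCat.of S B) :=
    (IsProjective.iff_projective (R := S) B).1 inferInstance
  rw [← ModuleCat.isZero_iff_subsingleton]
  exact isZero_Ext_succ_of_projective _ _ n

lemma GP_projective [Module.Finite S B] [Module.Projective S B] : IsGP S B :=
  ⟨Module.bijective_dual_eval S B, EV_projective, EV_projective⟩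

lemma dual_exact (j : A →ₗ[S] B) (p : B →ₗ[S] C) (hp : Surjective p) (hjp : Exact j p) :
    Exact p.dualMap j.dualMap := by
  intro ψ
  constructor
  · intro h
    have hk : LinearMap.ker p ≤ LinearMap.ker ψ := by
      intro x hx
      obtain ⟨a, rfl⟩ := (hjp x).1 hx
      exact LinearMap.congr_fun h a
    have e := p.quotKerEquivOfSurjective hp
    refine ⟨(Submodule.liftQ _ ψ hk) ∘ₗ (p.quotKerEquivOfSurjective hp).symm.toLinearMap, ?_⟩
    ext x
    have : (p.quotKerEquivOfSurjective hp).symm (p x) = Submodule.Quotient.mk x := by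
      rw [LinearEquiv.symm_apply_eq]; rfl
    simp [this]
  · rintro ⟨φ, rfl⟩
    ext x
    simp [hjp.apply_apply_eq_zero x]

lemma dual_inj (p : B →ₗ[S] C) (hp : Surjective p) : Injective p.dualMap := by
  intro φ ψ h
  ext c
  obtain ⟨b, rfl⟩ := hp c
  exact LinearMap.congr_fun h b

lemma dual_surj (j : A →ₗ[S] B) (h : ∀ φ : A →ₗ[S] S, ∃ ψ : B →ₗ[S] S, ψ ∘ₗ j = φ) :
    Surjective j.dualMap := h

lemma GP_kernel [Module.Finite S B] [Module.Projective S B] (j : A →ₗ[S] B) (p : B →ₗ[S] C)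
    (hj : Injective j) (hp : Surjective p) (hjp : Exact j p) (hC : IsGP S C) : IsGP S A := by
  obtain ⟨hCr, hC1, hC2⟩ := hC
  obtain ⟨hA1, hs⟩ := (EV_iff j p hj hp hjp).1 hC1
  have hBr := Module.bijective_dual_eval S B
  have hde := dual_exact j p hp hjp
  refine ⟨⟨?_, ?_⟩, hA1, ?_⟩
  · rw [injective_iff_map_eq_zero]
    intro a ha
    apply hj
    apply hBr.1
    ext ψ
    simpa using LinearMap.congr_fun ha (ψ ∘ₗ j)
  · intro ξ
    obtain ⟨b, hb⟩ := hBr.2 (ξ ∘ₗ j.dualMap)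
    have hb' : ∀ ψ : B →ₗ[S] S, ψ b = ξ (ψ ∘ₗ j) := fun ψ => LinearMap.congr_fun hb ψ
    have : p b = 0 := by
      apply hCr.1
      ext φ
      have h1 := hb' (φ ∘ₗ p)
      have h2 : (φ ∘ₗ p) ∘ₗ j = 0 := by
        ext x; simp [hjp.apply_apply_eq_zero x]
      rw [h2, map_zero] at h1
      simpa using h1
    obtain ⟨a, rfl⟩ := (hjp b).1 this
    refine ⟨a, ?_⟩
    ext φ
    obtain ⟨ψ, rfl⟩ := hs φ
    simpa using hb' ψ
  · refine (EV_iff p.dualMap j.dualMap (dual_inj p hp) (dual_surj j hs) hde).2 ⟨hC2, fun ξ => ?_⟩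
    obtain ⟨c, rfl⟩ := hCr.2 ξ
    obtain ⟨b, rfl⟩ := hp c
    exact ⟨Module.Dual.eval S B b, rfl⟩

lemma GP_coker [Module.Finite S B] [Module.Projective S B] (j : A →ₗ[S] B) (p : B →ₗ[S] C)
    (hj : Injective j) (hp : Surjective p) (hjp : Exact j p) (hA : IsGP S A)
    (hs : ∀ φ : A →ₗ[S] S, ∃ ψ : B →ₗ[S] S, ψ ∘ₗ j = φ) : IsGP S C := by
  obtain ⟨hAr, hA1, hA2⟩ := hA
  have hBr := Module.bijective_dual_eval S B
  have hde := dual_exact j p hp hjp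
  obtain ⟨hC2, hext⟩ := (EV_iff p.dualMap j.dualMap (dual_inj p hp) (dual_surj j hs) hde).1 hA2
  refine ⟨⟨?_, ?_⟩, (EV_iff j p hj hp hjp).2 ⟨hA1, hs⟩, hC2⟩
  · rw [injective_iff_map_eq_zero]
    intro c hc
    obtain ⟨b, rfl⟩ := hp c
    have hb : p.dualMap.dualMap (Module.Dual.eval S B b) = 0 := by
      ext φ
      exact LinearMap.congr_fun hc φ
    obtain ⟨ξ, hξ⟩ := (dual_exact p.dualMap j.dualMap (dual_surj j hs) hde _).1 hb
    obtain ⟨a, rfl⟩ := hAr.2 ξ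
    have : j a = b := by
      apply hBr.1
      rw [← hξ]
      rfl
    rw [← this, hjp.apply_apply_eq_zero]
  · intro ξ
    obtain ⟨η, rfl⟩ := hext ξ
    obtain ⟨b, rfl⟩ := hBr.2 η
    exact ⟨p b, rfl⟩

lemma extend_one (j : A →ₗ[S] B) (p : B →ₗ[S] C)
    (hj : Injective j) (hp : Surjective p) (hjp : Exact j p) (hC : EV S C) (φ : A →ₗ[S] S) :
    ∃ ψ : B →ₗ[S] S, ψ ∘ₗ j = φ := by
  let F := C →₀ S
  let π : F →ₗ[S] C := Finsupp.linearCombination S id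
  have hπ : Surjective π := Finsupp.linearCombination_id_surjective S C
  obtain ⟨-, hs⟩ := (EV_iff (A := LinearMap.ker π) (B := F) (C := C) (Submodule.subtype _) π (Submodule.subtype_injective _) hπ
    (LinearMap.exact_subtype_ker_map π)).1 hC
  obtain ⟨l, hl⟩ := Module.projective_lifting_property p π hp
  have hl' : ∀ x, p (l x) = π x := fun x => LinearMap.congr_fun hl x
  let m : A × F →ₗ[S] B := j.coprod l
  have hm : Surjective m := by
    intro b
    obtain ⟨x, hx⟩ := hπ (p b)
    obtain ⟨a, ha⟩ := (hjp (b - l x)).1 (by rw [map_sub, hl', hx, sub_self])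
    exact ⟨(a, x), by simp [m, ha]⟩
  let e : A ≃ₗ[S] LinearMap.range j := LinearEquiv.ofInjective j hj
  have hr : ∀ x : LinearMap.ker π, l x.1 ∈ LinearMap.range j := fun x =>
    (hjp _).1 (by rw [hl']; exact x.2)
  let k : LinearMap.ker π →ₗ[S] A :=
    e.symm.toLinearMap ∘ₗ (l ∘ₗ (LinearMap.ker π).subtype).codRestrict (LinearMap.range j) hr
  have hk : ∀ x : LinearMap.ker π, j (k x) = l x.1 := by
    intro x
    have := congrArg Subtype.val (e.apply_symm_apply ⟨l x.1, hr x⟩)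
    exact this
  obtain ⟨θ, hθ⟩ := hs (φ ∘ₗ k)
  have hker : LinearMap.ker m ≤ LinearMap.ker (φ.coprod θ) := by
    rintro ⟨a, x⟩ h
    have h : j a + l x = 0 := by simpa [m] using h
    have hx : x ∈ LinearMap.ker π := by
      rw [LinearMap.mem_ker, ← hl']
      have := congrArg p h
      simpa [hjp.apply_apply_eq_zero] using this
    have h1 : θ x = φ (k ⟨x, hx⟩) := LinearMap.congr_fun hθ ⟨x, hx⟩
    have h2 : a = - k ⟨x, hx⟩ := by
      apply hj
      rw [map_neg, hk]
      exact eq_neg_of_add_eq_zero_left h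
    rw [LinearMap.mem_ker, LinearMap.coprod_apply]
    simp [h1, h2]
  refine ⟨(Submodule.liftQ _ (φ.coprod θ) hker) ∘ₗ (m.quotKerEquivOfSurjective hm).symm.toLinearMap, ?_⟩
  ext a
  have : (m.quotKerEquivOfSurjective hm).symm (j a) = Submodule.Quotient.mk (a, 0) := by
    rw [LinearEquiv.symm_apply_eq]
    change j a = m (a, 0)
    simp [m]
  simp [this]

lemma extend_proj (j : A →ₗ[S] B) (p : B →ₗ[S] C)
    (hj : Injective j) (hp : Surjective p) (hjp : Exact j p) (hC : EV S C)
    {P : Type} [AddCommGroup P] [Module S P] [Module.Finite S P] [Module.Projective S P]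
    (φ : A →ₗ[S] P) :
    ∃ ψ : B →ₗ[S] P, ψ ∘ₗ j = φ := by
  obtain ⟨n, f, g, -, -, hfg⟩ := Module.Finite.exists_comp_eq_id_of_projective S P
  choose ψ hψ using fun i => extend_one j p hj hp hjp hC (LinearMap.proj i ∘ₗ g ∘ₗ φ)
  refine ⟨f ∘ₗ LinearMap.pi ψ, ?_⟩
  have : LinearMap.pi ψ ∘ₗ j = g ∘ₗ φ := by
    ext a i
    exact LinearMap.congr_fun (hψ i) a
  rw [LinearMap.comp_assoc, this, ← LinearMap.comp_assoc, hfg, LinearMap.id_comp]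

lemma exists_h {ω : S} (g : A →ₗ[S] B) (hg : Injective g) (h : ∀ y, ω • y ∈ LinearMap.range g) :
    ∃ k : B →ₗ[S] A, (∀ y, g (k y) = ω • y) ∧ ∀ x, k (g x) = ω • x := by
  let e : A ≃ₗ[S] LinearMap.range g := LinearEquiv.ofInjective g hg
  let k : B →ₗ[S] A := e.symm.toLinearMap ∘ₗ (ω • LinearMap.id).codRestrict (LinearMap.range g) h
  have hk : ∀ y, g (k y) = ω • y := fun y =>
    congrArg Subtype.val (e.apply_symm_apply ⟨ω • y, h y⟩)
  exact ⟨k, hk, fun x => hg (by rw [hk, map_smul])⟩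

lemma GP_torsionfree {ω : S} (hreg : ω ∈ nonZeroDivisors S) (hA : IsGP S A) (x : A)
    (h : ω • x = 0) : x = 0 := by
  apply hA.1.1
  ext φ
  have := congrArg φ h
  rw [map_smul, map_zero, smul_eq_mul] at this
  simpa using (mem_nonZeroDivisors_iff.1 hreg).1 _ this

lemma GP_embed [IsNoetherianRing S] [Module.Finite S A] (hA : IsGP S A) :
    ∃ (n : ℕ) (j : A →ₗ[S] (Fin n → S)), Injective j ∧
      ∀ φ : A →ₗ[S] S, ∃ ψ : (Fin n → S) →ₗ[S] S, ψ ∘ₗ j = φ := by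
  obtain ⟨n, s, hs⟩ := Module.Finite.exists_fin (R := S) (M := Module.Dual S A)
  have hext : ∀ φ : A →ₗ[S] S, ∃ ψ : (Fin n → S) →ₗ[S] S, ψ ∘ₗ (LinearMap.pi s) = φ := by
    intro φ
    have : φ ∈ Submodule.span S (Set.range s) := by rw [hs]; trivial
    obtain ⟨c, hc⟩ := (Submodule.mem_span_range_iff_exists_fun S).1 this
    refine ⟨∑ i, c i • LinearMap.proj i, ?_⟩
    rw [← hc]
    ext x
    simp
  refine ⟨n, LinearMap.pi s, ?_, hext⟩
  rw [injective_iff_map_eq_zero]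
  intro x hx
  apply hA.1.1
  ext φ
  obtain ⟨ψ, rfl⟩ := hext φ
  simp [hx]
end

section main
variable {S : Type} [CommRing S] {ω : S}
    {G1 G0 : Type} [AddCommGroup G1] [Module S G1] [AddCommGroup G0] [Module S G0]
    {g1 : G1 →ₗ[S] G0}

lemma proj_of_std (hg1 : MonObj S ω g1) (h : IsSummandOfStdObj S ω g1) :
    IsProjObjMon S ω g1 := by
  obtain ⟨P, Q, hP1, hP2, hQ1, hQ2, s1, s0, r1, r0, hs, hr, hrs1, hrs0⟩ := h
  intro A1 A0 B1 B0 a b α1 α0 β1 β0 ha hb hα hβ hi1 hi0 he1 he0 hs1 hs0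
  obtain ⟨-, -, -, -, hbi, hbr⟩ := hb
  obtain ⟨-, -, -, -, hgi, -⟩ := hg1
  obtain ⟨k, hk1, hk2⟩ := exists_h b hbi hbr
  obtain ⟨u, hu⟩ := Module.projective_lifting_property β1 (r1 ∘ₗ LinearMap.inl S P Q) hs1
  obtain ⟨v, hv⟩ := Module.projective_lifting_property β0 (r0 ∘ₗ LinearMap.inr S P Q) hs0
  have hu' : ∀ x, β1 (u x) = r1 (x, 0) := fun x => LinearMap.congr_fun hu x
  have hv' : ∀ x, β0 (v x) = r0 (0, x) := fun x => LinearMap.congr_fun hv x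
  have hβ' : ∀ x, g1 (β1 x) = β0 (b x) := fun x => LinearMap.congr_fun hβ x
  have hr' : ∀ p q, g1 (r1 (p, q)) = r0 (p, ω • q) := fun p q => LinearMap.congr_fun hr (p, q)
  have hs' : ∀ x, s0 (g1 x) = ((s1 x).1, ω • (s1 x).2) := fun x => (LinearMap.congr_fun hs x).symm
  have hsm : ∀ q : Q, ((0 : P), ω • q) = ω • ((0 : P), q) := fun q => by
    rw [Prod.smul_mk, smul_zero]
  refine ⟨(u.coprod (k ∘ₗ v)) ∘ₗ s1, ((b ∘ₗ u).coprod v) ∘ₗ s0, ?_, ?_, ?_⟩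
  · ext x
    change b (u (s1 x).1 + k (v (s1 x).2)) = b (u (s0 (g1 x)).1) + v (s0 (g1 x)).2
    rw [hs', map_add, hk1, map_smul]
  · ext x
    change β1 (u (s1 x).1 + k (v (s1 x).2)) = x
    have : β1 (k (v (s1 x).2)) = r1 (0, (s1 x).2) := by
      apply hgi
      rw [hβ', hk1, map_smul, hv', hr', hsm, map_smul]
    rw [map_add, this, hu', ← map_add, Prod.mk_add_mk, add_zero, zero_add]
    exact LinearMap.congr_fun hrs1 x
  · ext x
    change β0 (b (u (s0 x).1) + v (s0 x).2) = x
    rw [map_add, ← hβ', hu', hr', hv', smul_zero, ← map_add, Prod.mk_add_mk, add_zero, zero_add]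
    exact LinearMap.congr_fun hrs0 x

lemma inj_of_std (hreg : ω ∈ nonZeroDivisors S) (hg1 : MonObj S ω g1)
    (h : IsSummandOfStdObj S ω g1) : IsInjObjMon S ω g1 := by
  obtain ⟨P, Q, hP1, hP2, hQ1, hQ2, s1, s0, r1, r0, hs, hr, hrs1, hrs0⟩ := h
  intro B1 B0 C1 C0 b c α1 α0 β1 β0 hb hc hα hβ hi1 hi0 he1 he0 hs1 hs0
  obtain ⟨-, -, -, -, hbi, hbr⟩ := hb
  obtain ⟨-, -, -, -, hgi, hgr⟩ := hg1
  obtain ⟨-, -, hC1, hC0, -, -⟩ := hc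
  obtain ⟨k, hk1, hk2⟩ := exists_h b hbi hbr
  obtain ⟨h, hh1, hh2⟩ := exists_h g1 hgi hgr
  obtain ⟨u, hu⟩ := extend_proj α0 β0 hi0 hs0 he0 hC0.2.1 (LinearMap.fst S P Q ∘ₗ s0)
  obtain ⟨v, hv⟩ := extend_proj α1 β1 hi1 hs1 he1 hC1.2.1 (LinearMap.snd S P Q ∘ₗ s1)
  have hu' : ∀ x, u (α0 x) = (s0 x).1 := fun x => LinearMap.congr_fun hu x
  have hv' : ∀ x, v (α1 x) = (s1 x).2 := fun x => LinearMap.congr_fun hv x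
  have hα' : ∀ x, b (α1 x) = α0 (g1 x) := fun x => LinearMap.congr_fun hα x
  have hr' : ∀ p q, g1 (r1 (p, q)) = r0 (p, ω • q) := fun p q => LinearMap.congr_fun hr (p, q)
  have hs' : ∀ x, s0 (g1 x) = ((s1 x).1, ω • (s1 x).2) := fun x => (LinearMap.congr_fun hs x).symm
  have hkα : ∀ x, k (α0 x) = α1 (h x) := fun x => hbi (by rw [hk1, hα', hh1, map_smul])
  refine ⟨r1 ∘ₗ (u ∘ₗ b).prod v, r0 ∘ₗ u.prod (v ∘ₗ k), ?_, ?_, ?_⟩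
  · ext x
    change g1 (r1 (u (b x), v x)) = r0 (u (b x), v (k (b x)))
    rw [hr', hk2, map_smul]
  · ext x
    change r1 (u (b (α1 x)), v (α1 x)) = x
    rw [hα', hu', hs', hv']
    exact LinearMap.congr_fun hrs1 x
  · ext x
    change r0 (u (α0 x), v (k (α0 x))) = x
    have : (s1 (h x)).2 = (s0 x).2 := by
      rw [← sub_eq_zero]
      apply GP_torsionfree (S := S) hreg GP_projective
      have h1 := congrArg Prod.snd (hs' (h x))
      rw [hh1, map_smul] at h1
      rw [smul_sub, sub_eq_zero]
      exact h1.symm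
    rw [hkα, hv', hu', this]
    exact LinearMap.congr_fun hrs0 x

/-- The standard object `(id : P → P) ⊕ (ω : Q → Q)`. -/
def stdMap (S : Type) [CommRing S] (ω : S) (P Q : Type) [AddCommGroup P] [Module S P]
    [AddCommGroup Q] [Module S Q] : P × Q →ₗ[S] P × Q :=
  (LinearMap.id : P →ₗ[S] P).prodMap (ω • (LinearMap.id : Q →ₗ[S] Q))

lemma stdMap_apply {P Q : Type} [AddCommGroup P] [Module S P]
    [AddCommGroup Q] [Module S Q] (x : P × Q) : stdMap S ω P Q x = (x.1, ω • x.2) := rfl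

lemma stdMap_obj (hreg : ω ∈ nonZeroDivisors S) {P Q : Type} [AddCommGroup P] [Module S P]
    [AddCommGroup Q] [Module S Q] [Module.Finite S P] [Module.Projective S P]
    [Module.Finite S Q] [Module.Projective S Q] : MonObj S ω (stdMap S ω P Q) := by
  refine ⟨inferInstance, inferInstance, GP_projective, GP_projective, ?_, ?_⟩
  · rw [injective_iff_map_eq_zero]
    rintro ⟨p, q⟩ h
    rw [stdMap_apply, Prod.mk_eq_zero] at h
    rw [Prod.mk_eq_zero]
    exact ⟨h.1, GP_torsionfree hreg GP_projective _ h.2⟩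
  · rintro ⟨p, q⟩
    exact ⟨(ω • p, q), rfl⟩

lemma std_of_proj [IsNoetherianRing S] (hreg : ω ∈ nonZeroDivisors S) (hg1 : MonObj S ω g1)
    (hX : IsProjObjMon S ω g1) : IsSummandOfStdObj S ω g1 := by
  obtain ⟨hf1, hf0, hG1, hG0, hgi, hgr⟩ := hg1
  obtain ⟨h, hh1, hh2⟩ := exists_h g1 hgi hgr
  obtain ⟨m, π1, hπ1⟩ := Module.Finite.exists_fin' S G1
  obtain ⟨n, π0, hπ0⟩ := Module.Finite.exists_fin' S G0
  let P := Fin m → S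
  let Q := Fin n → S
  let β1 : P × Q →ₗ[S] G1 := π1.coprod (h ∘ₗ π0)
  let β0 : P × Q →ₗ[S] G0 := (g1 ∘ₗ π1).coprod π0
  have hβ1 : ∀ x, β1 x = π1 x.1 + h (π0 x.2) := fun x => rfl
  have hβ0 : ∀ x, β0 x = g1 (π1 x.1) + π0 x.2 := fun x => rfl
  let b := stdMap S ω P Q
  have hb : MonObj S ω b := stdMap_obj hreg
  have hβ : ∀ x, g1 (β1 x) = β0 (b x) := fun x => by
    rw [hβ1, hβ0, map_add, hh1, stdMap_apply, map_smul]
  have hs1 : Surjective β1 := fun y => by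
    obtain ⟨x, rfl⟩ := hπ1 y
    exact ⟨(x, 0), by rw [hβ1, map_zero, map_zero, add_zero]⟩
  have hs0 : Surjective β0 := fun y => by
    obtain ⟨x, rfl⟩ := hπ0 y
    exact ⟨(0, x), by rw [hβ0, map_zero, map_zero, zero_add]⟩
  let a : LinearMap.ker β1 →ₗ[S] LinearMap.ker β0 := b.restrict (fun x hx => by
    rw [LinearMap.mem_ker] at hx ⊢
    rw [← hβ, hx, map_zero])
  have he1 : Exact (LinearMap.ker β1).subtype β1 := LinearMap.exact_subtype_ker_map β1
  have he0 : Exact (LinearMap.ker β0).subtype β0 := LinearMap.exact_subtype_ker_map β0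
  have ha : MonObj S ω a := by
    refine ⟨inferInstance, inferInstance,
      GP_kernel _ β1 (Submodule.subtype_injective _) hs1 he1 hG1,
      GP_kernel _ β0 (Submodule.subtype_injective _) hs0 he0 hG0, ?_, ?_⟩
    · intro x y hxy
      exact Subtype.ext (hb.2.2.2.2.1 (congrArg Subtype.val hxy))
    · rintro ⟨⟨p, q⟩, hy⟩
      refine ⟨⟨(ω • p, q), ?_⟩, rfl⟩
      rw [LinearMap.mem_ker] at hy ⊢
      apply hgi
      rw [hβ, map_zero]
      change β0 (ω • (p, q)) = 0
      rw [map_smul, hy, smul_zero]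
  obtain ⟨ψ1, ψ0, hψ, h1, h0⟩ := hX (ModuleCat.of S (LinearMap.ker β1))
    (ModuleCat.of S (LinearMap.ker β0)) (ModuleCat.of S (P × Q)) (ModuleCat.of S (P × Q))
    a b (LinearMap.ker β1).subtype (LinearMap.ker β0).subtype β1 β0 ha hb rfl
    (LinearMap.ext hβ) (Submodule.subtype_injective _) (Submodule.subtype_injective _)
    he1 he0 hs1 hs0
  exact ⟨ModuleCat.of S P, ModuleCat.of S Q, (inferInstance : Module.Finite S P),
    (inferInstance : Module.Projective S P), (inferInstance : Module.Finite S Q),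
    (inferInstance : Module.Projective S Q), ψ1, ψ0, β1, β0, hψ, LinearMap.ext hβ, h1, h0⟩

lemma std_of_inj [IsNoetherianRing S] (hreg : ω ∈ nonZeroDivisors S) (hg1 : MonObj S ω g1)
    (hX : IsInjObjMon S ω g1) : IsSummandOfStdObj S ω g1 := by
  obtain ⟨hf1, hf0, hG1, hG0, hgi, hgr⟩ := hg1
  obtain ⟨h, hh1, hh2⟩ := exists_h g1 hgi hgr
  obtain ⟨m, ι0, hι0, hx0⟩ := GP_embed hG0
  obtain ⟨n, ι1, hι1, hx1⟩ := GP_embed hG1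
  let P := Fin m → S
  let Q := Fin n → S
  let α1 : G1 →ₗ[S] P × Q := (ι0 ∘ₗ g1).prod ι1
  let α0 : G0 →ₗ[S] P × Q := ι0.prod (ι1 ∘ₗ h)
  have hα1 : ∀ x, α1 x = (ι0 (g1 x), ι1 x) := fun x => rfl
  have hα0 : ∀ x, α0 x = (ι0 x, ι1 (h x)) := fun x => rfl
  let b := stdMap S ω P Q
  have hb : MonObj S ω b := stdMap_obj hreg
  have hα : ∀ x, b (α1 x) = α0 (g1 x) := fun x => by
    rw [hα1, hα0, hh2, stdMap_apply, map_smul]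
  have hi1 : Injective α1 := fun x y hxy => hι1 (congrArg Prod.snd hxy)
  have hi0 : Injective α0 := fun x y hxy => hι0 (congrArg Prod.fst hxy)
  have hE1 : ∀ φ : G1 →ₗ[S] S, ∃ ψ : P × Q →ₗ[S] S, ψ ∘ₗ α1 = φ := fun φ => by
    obtain ⟨ψ, rfl⟩ := hx1 φ
    exact ⟨ψ ∘ₗ LinearMap.snd S P Q, rfl⟩
  have hE0 : ∀ φ : G0 →ₗ[S] S, ∃ ψ : P × Q →ₗ[S] S, ψ ∘ₗ α0 = φ := fun φ => by
    obtain ⟨ψ, rfl⟩ := hx0 φ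
    exact ⟨ψ ∘ₗ LinearMap.fst S P Q, rfl⟩
  have he1 : Exact α1 (LinearMap.range α1).mkQ := LinearMap.exact_map_mkQ_range α1
  have he0 : Exact α0 (LinearMap.range α0).mkQ := LinearMap.exact_map_mkQ_range α0
  have hL : IsGP S (Q ⧸ LinearMap.range ι1) := GP_coker ι1 (LinearMap.range ι1).mkQ hι1
    (Submodule.mkQ_surjective _) (LinearMap.exact_map_mkQ_range ι1) hG1 hx1
  let c : ((P × Q) ⧸ LinearMap.range α1) →ₗ[S] ((P × Q) ⧸ LinearMap.range α0) :=
    Submodule.mapQ _ _ b (by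
      rintro _ ⟨x, rfl⟩
      exact ⟨g1 x, (hα x).symm⟩)
  have hc : MonObj S ω c := by
    refine ⟨inferInstance, inferInstance,
      GP_coker α1 _ hi1 (Submodule.mkQ_surjective _) he1 hG1 hE1,
      GP_coker α0 _ hi0 (Submodule.mkQ_surjective _) he0 hG0 hE0, ?_, ?_⟩
    · rw [injective_iff_map_eq_zero]
      intro y hy
      obtain ⟨⟨p, q⟩, rfl⟩ := Submodule.mkQ_surjective _ y
      have hy' : b (p, q) ∈ LinearMap.range α0 := (Submodule.Quotient.mk_eq_zero _).1 hy
      obtain ⟨x, hx⟩ := hy'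
      rw [hα0, stdMap_apply, Prod.mk.injEq] at hx
      obtain ⟨hxp, hxq⟩ := hx
      have hq : (LinearMap.range ι1).mkQ q = 0 := by
        apply GP_torsionfree hreg hL
        rw [← map_smul]
        exact (Submodule.Quotient.mk_eq_zero _).2 ⟨h x, hxq⟩
      obtain ⟨z, rfl⟩ := (Submodule.Quotient.mk_eq_zero _).1 hq
      have hz : h x = ω • z := hι1 (by rw [hxq, map_smul])
      have hxz : x = g1 z := by
        rw [← sub_eq_zero]
        apply GP_torsionfree hreg hG0
        rw [smul_sub, ← hh1, hz, map_smul, sub_self]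
      refine (Submodule.Quotient.mk_eq_zero _).2 ⟨z, ?_⟩
      rw [hα1, ← hxz, hxp]
    · intro y
      obtain ⟨⟨p, q⟩, rfl⟩ := Submodule.mkQ_surjective _ y
      exact ⟨(LinearMap.range α1).mkQ (ω • p, q), rfl⟩
  obtain ⟨ψ1, ψ0, hψ, h1, h0⟩ := hX (ModuleCat.of S (P × Q)) (ModuleCat.of S (P × Q))
    (ModuleCat.of S ((P × Q) ⧸ LinearMap.range α1)) (ModuleCat.of S ((P × Q) ⧸ LinearMap.range α0))
    b c α1 α0 (LinearMap.range α1).mkQ (LinearMap.range α0).mkQ hb hc (LinearMap.ext hα)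
    rfl hi1 hi0 he1 he0 (Submodule.mkQ_surjective _) (Submodule.mkQ_surjective _)
  exact ⟨ModuleCat.of S P, ModuleCat.of S Q, (inferInstance : Module.Finite S P),
    (inferInstance : Module.Projective S P), (inferInstance : Module.Finite S Q),
    (inferInstance : Module.Projective S Q), α1, α0, ψ1, ψ0, LinearMap.ext hα, hψ, h1, h0⟩

end main

/-- for an object `X = (g1 : G1 → G0)` of `Mon(ω, 𝒢)` the following are
equivalent: (i) `X` is projective, (ii) `X` is injective, (iii) `X` is a direct summand
of an object `(id : P → P) ⊕ (ω : Q → Q)` with `P, Q` finitely generated projective. -/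
theorem stmt_9 (S : Type) [CommRing S] [IsNoetherianRing S] [IsLocalRing S]
    (ω : S) (hω : ω ∈ IsLocalRing.maximalIdeal S) (hreg : ω ∈ nonZeroDivisors S)
    (G1 G0 : Type) [AddCommGroup G1] [Module S G1] [AddCommGroup G0] [Module S G0]
    (g1 : G1 →ₗ[S] G0) (hg1 : MonObj S ω g1) :
    (IsProjObjMon S ω g1 ↔ IsInjObjMon S ω g1) ∧
    (IsProjObjMon S ω g1 ↔ IsSummandOfStdObj S ω g1) := by
  have h1 : IsProjObjMon S ω g1 ↔ IsSummandOfStdObj S ω g1 :=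
    ⟨std_of_proj hreg hg1, proj_of_std hg1⟩
  have h2 : IsInjObjMon S ω g1 ↔ IsSummandOfStdObj S ω g1 :=
    ⟨std_of_inj hreg hg1, inj_of_std hreg hg1⟩
  exact ⟨h1.trans h2.symm, h1⟩
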